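/- arXiv:2010.03248 — 19 statements merged into one kernel-verified Lean document; each statement's English description precedes it below -/
import Mathlib

section
/- Let R be a commutative ring and let 𝒜 be a subset of Spec(R). Then 𝒜 has the prime avoidance property for R if and only if 𝒜 is compact in the Zariski topology (as a subspace of Spec(R)) and 𝒜 has the prime avoidance property for all finitely generated ideals of R (i.e., every finitely generated ideal contained in the union of the primes in 𝒜 is contained in one of them). -/
/-- `𝒜 ⊆ Spec R` has the prime avoidance property for `R` iff `𝒜` is
compact in the Zariski topology and `𝒜` has the prime avoidance property for all
finitely generated ideals of `R`. -/
theorem prime_avoidance_iff_compact_and_fg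
    {R : Type*} [CommRing R] (𝒜 : Set (PrimeSpectrum R)) :
    (∀ I : Ideal R, (I : Set R) ⊆ ⋃ P ∈ 𝒜, (P.asIdeal : Set R) →
        ∃ P ∈ 𝒜, I ≤ P.asIdeal) ↔
      (IsCompact 𝒜 ∧
        ∀ I : Ideal R, I.FG → (I : Set R) ⊆ ⋃ P ∈ 𝒜, (P.asIdeal : Set R) →
          ∃ P ∈ 𝒜, I ≤ P.asIdeal) := by
  constructor
  · intro h
    refine ⟨?_, fun I _ => h I⟩
    apply isCompact_of_finite_subcover
    intro ι U hU hcov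
    choose s hs using fun i => (PrimeSpectrum.isOpen_iff (U i)).1 (hU i)
    by_contra hcon
    push Not at hcon
    have hsub : ((⨆ i, Ideal.span (s i) : Ideal R) : Set R) ⊆
        ⋃ P ∈ 𝒜, (P.asIdeal : Set R) := by
      intro x hx
      obtain ⟨t, ht⟩ := (Submodule.mem_iSup_iff_exists_finset).1 hx
      obtain ⟨P, hP, hPt⟩ := Set.not_subset.1 (hcon t)
      refine Set.mem_iUnion₂.2 ⟨P, hP, ?_⟩
      have hle : (⨆ i ∈ t, Ideal.span (s i) : Ideal R) ≤ P.asIdeal := by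
        refine iSup₂_le fun i hi => Ideal.span_le.2 ?_
        have h1 : P ∈ (U i)ᶜ := fun h2 => hPt (Set.mem_iUnion₂.2 ⟨i, hi, h2⟩)
        rw [hs i] at h1
        exact h1
      exact hle ht
    obtain ⟨P, hP, hle⟩ := h _ hsub
    obtain ⟨i, hi⟩ := Set.mem_iUnion.1 (hcov hP)
    have h1 : P ∈ (U i)ᶜ := by
      rw [hs i]
      exact Ideal.span_le.1 ((le_iSup (fun i => Ideal.span (s i)) i).trans hle)
    exact h1 hi
  · rintro ⟨hc, h⟩ I hI
    by_contra hcon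
    push Not at hcon
    obtain ⟨t, ht⟩ := hc.elim_finite_subcover
      (fun f : I => (PrimeSpectrum.basicOpen (f : R) : Set (PrimeSpectrum R)))
      (fun f => (PrimeSpectrum.basicOpen (f : R)).isOpen) (by
        intro P hP
        obtain ⟨x, hx, hxP⟩ := SetLike.not_le_iff_exists.1 (hcon P hP)
        exact Set.mem_iUnion.2 ⟨⟨x, hx⟩, hxP⟩)
    have hle : Ideal.span ((fun f : I => (f : R)) '' (t : Set I)) ≤ I := by
      rw [Ideal.span_le]
      rintro _ ⟨f, _, rfl⟩
      exact f.2
    obtain ⟨P, hP, hPle⟩ := h _ (Submodule.fg_span (t.finite_toSet.image _))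
      (Set.Subset.trans hle hI)
    obtain ⟨f, hf, hfP⟩ := Set.mem_iUnion₂.1 (ht hP)
    exact hfP (hPle (Ideal.subset_span ⟨f, hf, rfl⟩))
end

section
/- Let R be a commutative ring. The set Min(R) of minimal prime ideals of R is finite if and only if Min(R) is compact in the Zariski topology (as a subspace of Spec(R)) and for each minimal prime P_β of R, the intersection ⋂_{α≠β} P_α of all the other minimal primes is not contained in P_β. -/
/-- `Min(R)` is finite iff `Min(R)` is compact in the Zariski topology
and for each minimal prime `P`, the intersection of all the other minimal primes is
not contained in `P`. -/
theorem minimalPrimes_finite_iff_compact_and_not_le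
    {R : Type*} [CommRing R] :
    ({P : PrimeSpectrum R | P.asIdeal ∈ minimalPrimes R}).Finite ↔
      (IsCompact {P : PrimeSpectrum R | P.asIdeal ∈ minimalPrimes R} ∧
        ∀ P ∈ {P : PrimeSpectrum R | P.asIdeal ∈ minimalPrimes R},
          ¬ ((⨅ Q ∈ {Q : PrimeSpectrum R | Q.asIdeal ∈ minimalPrimes R} \ {P},
                Q.asIdeal) ≤ P.asIdeal)) := by
  constructor
  · intro h
    refine ⟨h.isCompact, fun P hP hle => ?_⟩
    have hfin := h.subset (Set.diff_subset (t := {P}))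
    have hle2 : hfin.toFinset.inf (fun Q : PrimeSpectrum R => Q.asIdeal) ≤ P.asIdeal := by
      rw [Finset.inf_eq_iInf]
      simpa only [Set.Finite.mem_toFinset] using hle
    obtain ⟨Q, hQ, hQP⟩ := (Ideal.IsPrime.inf_le' P.2).1 hle2
    rw [Set.Finite.mem_toFinset] at hQ
    apply hQ.2
    have h2 : P.asIdeal ≤ Q.asIdeal := hP.2 ⟨Q.2, bot_le⟩ hQP
    exact PrimeSpectrum.ext (le_antisymm hQP h2)
  · rintro ⟨hc, h⟩
    have key : ∀ P : PrimeSpectrum R, ∃ f : R, P.asIdeal ∈ minimalPrimes R →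
        f ∉ P.asIdeal ∧ ∀ Q : PrimeSpectrum R, Q.asIdeal ∈ minimalPrimes R →
          f ∉ Q.asIdeal → Q = P := by
      intro P
      by_cases hP : P.asIdeal ∈ minimalPrimes R
      · obtain ⟨f, hf, hfP⟩ := SetLike.not_le_iff_exists.1 (h P hP)
        refine ⟨f, fun _ => ⟨hfP, fun Q hQ hfQ => ?_⟩⟩
        by_contra hne
        apply hfQ
        simp only [Submodule.mem_iInf] at hf
        exact hf Q ⟨hQ, hne⟩
      · exact ⟨0, fun h => absurd h hP⟩
    choose f hf using key
    obtain ⟨t, ht, htf, hsub⟩ := hc.elim_finite_subcover_image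
      (b := {P : PrimeSpectrum R | P.asIdeal ∈ minimalPrimes R})
      (c := fun P => (PrimeSpectrum.basicOpen (f P) : Set (PrimeSpectrum R)))
      (fun P _ => (PrimeSpectrum.basicOpen (f P)).isOpen)
      (fun P hP => Set.mem_biUnion hP (hf P hP).1)
    refine htf.subset fun Q hQ => ?_
    obtain ⟨P, hP, hQP⟩ := Set.mem_iUnion₂.1 (hsub hQ)
    have : Q = P := (hf P (ht hP)).2 Q hQ hQP
    rwa [this]
end

section
/- Let R be a commutative ring and 𝒜 ⊆ Spec(R). If 𝒜 does not have the prime avoidance property for R, then there exists a prime ideal Q of R with Q ∉ 𝒜 such that ⋂_{P∈𝒜} P ⊆ Q. -/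
/-- if `𝒜 ⊆ Spec R` does not have the prime avoidance property for `R`,
then there is a prime ideal `Q ∉ 𝒜` containing the intersection of the members of `𝒜`. -/
theorem exists_prime_not_mem_of_not_prime_avoidance
    {R : Type*} [CommRing R] (𝒜 : Set (PrimeSpectrum R))
    (h : ¬ ∀ I : Ideal R, (I : Set R) ⊆ ⋃ P ∈ 𝒜, (P.asIdeal : Set R) →
        ∃ P ∈ 𝒜, I ≤ P.asIdeal) :
    ∃ Q : PrimeSpectrum R, Q ∉ 𝒜 ∧ (⨅ P ∈ 𝒜, P.asIdeal) ≤ Q.asIdeal := by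
  by_contra hQ
  push Not at hQ
  apply h
  intro I hI
  have hne : I ⊔ (⨅ P ∈ 𝒜, P.asIdeal) ≠ ⊤ := by
    intro ht
    rw [Ideal.eq_top_iff_one, Submodule.mem_sup] at ht
    obtain ⟨i, hi, j, hj, hij⟩ := ht
    have hi' := hI hi
    simp only [Set.mem_iUnion, SetLike.mem_coe] at hi'
    obtain ⟨P, hP, hiP⟩ := hi'
    have hjP : j ∈ P.asIdeal := (iInf₂_le P hP : (⨅ P ∈ 𝒜, P.asIdeal) ≤ P.asIdeal) hj
    apply P.isPrime.ne_top
    rw [Ideal.eq_top_iff_one, ← hij]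
    exact P.asIdeal.add_mem hiP hjP
  obtain ⟨M, hM, hle⟩ := Ideal.exists_le_maximal _ hne
  by_cases hMA : (⟨M, hM.isPrime⟩ : PrimeSpectrum R) ∈ 𝒜
  · exact ⟨_, hMA, le_sup_left.trans hle⟩
  · exact absurd (le_sup_right.trans hle) (hQ ⟨M, hM.isPrime⟩ hMA)
end

section
/- Let R be a commutative ring, 𝒜 ⊆ Spec(R), and let I be an ideal of R such that I ⊆ ⋃_{P∈𝒜} P. Then either there exists a prime ideal P ∈ 𝒜 with I ⊆ P, or 𝒜 is a proper subset of V(Ann(I)) = {Q ∈ Spec(R) : Ann(I) ⊆ Q}; moreover, in the latter case I + Ann(I) is a proper ideal of R. -/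
/-- if an ideal `I` is contained in the union of the primes in `𝒜`, then
either `I` is contained in some member of `𝒜`, or `𝒜` is a proper subset of
`V(Ann I)` and moreover `I + Ann I` is a proper ideal of `R`. -/
theorem avoidance_or_ssubset_annihilator
    {R : Type*} [CommRing R] (𝒜 : Set (PrimeSpectrum R)) (I : Ideal R)
    (hI : (I : Set R) ⊆ ⋃ P ∈ 𝒜, (P.asIdeal : Set R)) :
    (∃ P ∈ 𝒜, I ≤ P.asIdeal) ∨
      (𝒜 ⊂ {Q : PrimeSpectrum R | I.annihilator ≤ Q.asIdeal} ∧
        I ⊔ I.annihilator ≠ ⊤) := by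
  by_cases h : ∃ P ∈ 𝒜, I ≤ P.asIdeal
  · exact Or.inl h
  right
  have hsub : ∀ P ∈ 𝒜, I.annihilator ≤ P.asIdeal := by
    intro P hP r hr
    have hn : ¬ I ≤ P.asIdeal := fun hle => h ⟨P, hP, hle⟩
    obtain ⟨x, hx, hxP⟩ := SetLike.not_le_iff_exists.mp hn
    have h0 : r * x = 0 := Submodule.mem_annihilator.mp hr x hx
    have hm : r * x ∈ P.asIdeal := h0 ▸ P.asIdeal.zero_mem
    exact (P.isPrime.mem_or_mem hm).resolve_right hxP
  have hne : I ⊔ I.annihilator ≠ ⊤ := by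
    intro ht
    have h1 : (1 : R) ∈ I ⊔ I.annihilator := ht ▸ Submodule.mem_top
    obtain ⟨a, ha, b, hb, hab⟩ := Submodule.mem_sup.mp h1
    obtain ⟨P, hP, haP⟩ := Set.mem_iUnion₂.mp (hI ha)
    exact P.isPrime.ne_top
      ((Ideal.eq_top_iff_one _).mpr (hab ▸ P.asIdeal.add_mem haP (hsub P hP hb)))
  refine ⟨⟨hsub, fun hsup => ?_⟩, hne⟩
  obtain ⟨M, hM, hle⟩ := Ideal.exists_le_maximal _ hne
  exact h ⟨⟨M, hM.isPrime⟩, hsup (show I.annihilator ≤ M from le_sup_right.trans hle),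
    le_sup_left.trans hle⟩
end

section
/- Let R be a commutative zero-dimensional ring (every prime ideal of R is maximal) and let 𝒜 ⊆ Spec(R) be compact in the Zariski topology. Then 𝒜 has the prime avoidance property for R. -/
/-- In a zero-dimensional ring every element is strongly pi-regular. -/
lemma exists_pow_mul_eq_zero_aux {R : Type*} [CommRing R]
    (hzd : ∀ P : Ideal R, P.IsPrime → P.IsMaximal) (a : R) :
    ∃ (n : ℕ) (r : R), a ^ n * (1 - a * r) = 0 := by
  let S : Submonoid R :=
    { carrier := {x | ∃ (n : ℕ) (r : R), a ^ n * (1 - a * r) = x}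
      one_mem' := ⟨0, 0, by simp⟩
      mul_mem' := by
        rintro _ _ ⟨n, r, rfl⟩ ⟨m, s, rfl⟩
        exact ⟨n + m, r + s - a * r * s, by ring⟩ }
  by_contra h
  have hd : Disjoint ((⊥ : Ideal R) : Set R) (S : Set R) := by
    rw [Set.disjoint_left]
    intro x hx hxS
    have hx0 : x = 0 := by simpa using hx
    subst hx0
    exact h hxS
  obtain ⟨P, hP, -, hPS⟩ := Ideal.exists_le_prime_disjoint ⊥ S hd
  have hM := hzd P hP
  rw [Set.disjoint_left] at hPS
  have haP : a ∉ P := fun h => hPS h ⟨1, 0, by simp⟩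
  obtain ⟨y, i, hi, hyi⟩ := hM.exists_inv haP
  have : 1 - a * y ∈ P := by
    have : 1 - a * y = i := by rw [← hyi]; ring
    rwa [this]
  exact hPS this ⟨0, y, by simp⟩

/-- in a zero-dimensional commutative ring (every prime ideal is maximal),
every compact subset of `Spec R` has the prime avoidance property for `R`. -/
theorem prime_avoidance_of_compact_of_zero_dimensional
    {R : Type*} [CommRing R]
    (hzd : ∀ P : Ideal R, P.IsPrime → P.IsMaximal)
    (𝒜 : Set (PrimeSpectrum R)) (h𝒜 : IsCompact 𝒜) :
    ∀ I : Ideal R, (I : Set R) ⊆ ⋃ P ∈ 𝒜, (P.asIdeal : Set R) →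
      ∃ P ∈ 𝒜, I ≤ P.asIdeal := by
  intro I hI
  by_contra! hne
  obtain ⟨c, hc⟩ := h𝒜.elim_directed_cover
    (fun a : I => (PrimeSpectrum.basicOpen (a : R) : Set (PrimeSpectrum R)))
    (fun a => (PrimeSpectrum.basicOpen (a : R)).isOpen)
    (by
      intro P hP
      obtain ⟨a, haI, haP⟩ := SetLike.not_le_iff_exists.mp (hne P hP)
      exact Set.mem_iUnion.mpr ⟨⟨a, haI⟩, haP⟩)
    (by
      rintro ⟨a, ha⟩ ⟨b, hb⟩
      obtain ⟨n, r, hr⟩ := exists_pow_mul_eq_zero_aux hzd a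
      have key : ∀ P : PrimeSpectrum R, a ∉ P.asIdeal → 1 - a * r ∈ P.asIdeal := by
        intro P h
        have h0 : a ^ n * (1 - a * r) ∈ P.asIdeal := by rw [hr]; exact zero_mem _
        exact (P.2.mem_or_mem h0).resolve_left fun h' => h (P.2.mem_of_pow_mem n h')
      have h1 : ∀ P : PrimeSpectrum R, a ∉ P.asIdeal → a + (1 - a * r) * b ∉ P.asIdeal := by
        intro P h h'
        exact h ((Ideal.add_mem_iff_left _ (Ideal.mul_mem_right b _ (key P h))).mp h')
      refine ⟨⟨a + (1 - a * r) * b, I.add_mem ha (I.mul_mem_left _ hb)⟩, ?_, ?_⟩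
      · intro P hP
        exact h1 P hP
      · intro P hP
        by_cases h : a ∈ P.asIdeal
        · intro h'
          have h2 := (Ideal.add_mem_iff_right _ h).mp h'
          rcases P.2.mem_or_mem h2 with h3 | h3
          · apply P.2.ne_top
            rw [Ideal.eq_top_iff_one]
            have := P.asIdeal.add_mem h3 (Ideal.mul_mem_right r _ h)
            simpa using this
          · exact hP h3
        · exact h1 P h)
  obtain ⟨P, hP, hcP⟩ := Set.mem_iUnion₂.mp (hI c.2)
  exact hc hP hcP
end

section
/- Let R be a commutative ring and let 𝒜 ⊆ Spec(R) be a set of pairwise incomparable prime ideals (no element of 𝒜 is contained in another) which has the prime avoidance property for R. Then there exist a commutative ring T and a ring homomorphism f : R → T such that 𝒜 = { f⁻¹(M) : M a maximal ideal of T }. -/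
/-- if `𝒜 ⊆ Spec R` consists of pairwise incomparable primes and has the
prime avoidance property for `R`, then `𝒜` is the set of preimages of the maximal
ideals of some ring `T` under a ring homomorphism `f : R → T`. -/
theorem exists_ringHom_of_incomparable_prime_avoidance
    {R : Type u} [CommRing R] (𝒜 : Set (PrimeSpectrum R))
    (hinc : ∀ P ∈ 𝒜, ∀ Q ∈ 𝒜, P ≠ Q → ¬ P.asIdeal ≤ Q.asIdeal)
    (hPA : ∀ I : Ideal R, (I : Set R) ⊆ ⋃ P ∈ 𝒜, (P.asIdeal : Set R) →
        ∃ P ∈ 𝒜, I ≤ P.asIdeal) :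
    ∃ (T : CommRingCat.{u}) (f : R →+* T),
      𝒜 = {P : PrimeSpectrum R | ∃ M : Ideal T, M.IsMaximal ∧ P.asIdeal = M.comap f} := by
  classical
  let S : Submonoid R := ⨅ P ∈ 𝒜, P.asIdeal.primeCompl
  have hS : ∀ x, x ∈ S ↔ ∀ P ∈ 𝒜, x ∉ P.asIdeal := by
    intro x
    simp only [S, Submonoid.mem_iInf]
    rfl
  have hd : ∀ P ∈ 𝒜, Disjoint (S : Set R) (P.asIdeal : Set R) := by
    intro P hP
    rw [Set.disjoint_left]
    intro x hx
    exact (hS x).1 hx P hP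
  have key : ∀ M : Ideal (Localization S), M.IsMaximal →
      ∃ Q ∈ 𝒜, M.comap (algebraMap R (Localization S)) ≤ Q.asIdeal := by
    intro M hM
    apply hPA
    intro x hx
    have h2 := ((IsLocalization.isPrime_iff_isPrime_disjoint S _ M).1 hM.isPrime).2
    by_contra hcon
    refine Set.disjoint_left.1 h2 ((hS x).2 ?_) hx
    intro P hP hxP
    exact hcon (Set.mem_biUnion hP hxP)
  refine ⟨CommRingCat.of (Localization S), algebraMap R (Localization S), ?_⟩
  ext P
  simp only [Set.mem_ofPred_eq]
  constructor
  · intro hP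
    have hne := (IsLocalization.map_algebraMap_ne_top_iff_disjoint S (Localization S) P.asIdeal).2
      (hd P hP)
    obtain ⟨M, hM, hle⟩ := Ideal.exists_le_maximal _ hne
    obtain ⟨Q, hQ, hMQ⟩ := key M hM
    have hPM := Ideal.map_le_iff_le_comap.1 hle
    have hPQ : P = Q := by
      by_contra h
      exact hinc P hP Q hQ h (hPM.trans hMQ)
    subst hPQ
    exact ⟨M, hM, le_antisymm hPM hMQ⟩
  · rintro ⟨M, hM, hPM⟩
    obtain ⟨Q, hQ, hMQ⟩ := key M hM
    have hne := (IsLocalization.map_algebraMap_ne_top_iff_disjoint S (Localization S) Q.asIdeal).2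
      (hd Q hQ)
    have h1 : M ≤ Q.asIdeal.map (algebraMap R (Localization S)) := by
      have := IsLocalization.map_under S (Localization S) M
      rw [← this]
      exact Ideal.map_mono hMQ
    have h2 := hM.eq_of_le hne h1
    have h3 := IsLocalization.under_map_of_isPrime_disjoint S (Localization S) Q.isPrime (hd Q hQ)
    have : P = Q := by
      apply PrimeSpectrum.ext
      rw [hPM]
      refine Eq.trans ?_ h3
      rw [← h2]
    exact this ▸ hQ
end

section
/- Let f : R → T be a homomorphism of commutative rings, and let 𝒜 be a family of ideals of T with the following property: whenever a subring-1 S of T (an additive subgroup of T closed under multiplication with 1 ∉ S) satisfies S ⊆ ⋃_{Q∈𝒜} Q, there exists Q ∈ 𝒜 with S ⊆ Q. Then the family 𝒜' = { f⁻¹(Q) : Q ∈ 𝒜 } of ideals of R has the same property for subrings-1 of R: whenever an additive subgroup S of R that is closed under multiplication and does not contain 1 satisfies S ⊆ ⋃_{Q∈𝒜} f⁻¹(Q), there exists Q ∈ 𝒜 with S ⊆ f⁻¹(Q). -/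
/-- if a family `𝒜` of ideals of `T` has the avoidance property for
subrings-1 of `T` (additive subgroups closed under multiplication not containing `1`),
then the family of contractions `f⁻¹(Q)`, `Q ∈ 𝒜`, has the avoidance property for
subrings-1 of `R`. -/
theorem contraction_avoidance_for_subrings_one
    {R T : Type*} [CommRing R] [CommRing T] (f : R →+* T) (𝒜 : Set (Ideal T))
    (h : ∀ S : AddSubgroup T, (∀ a ∈ S, ∀ b ∈ S, a * b ∈ S) → (1 : T) ∉ S →
        (S : Set T) ⊆ ⋃ Q ∈ 𝒜, (Q : Set T) → ∃ Q ∈ 𝒜, (S : Set T) ⊆ (Q : Set T)) :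
    ∀ S : AddSubgroup R, (∀ a ∈ S, ∀ b ∈ S, a * b ∈ S) → (1 : R) ∉ S →
      (S : Set R) ⊆ ⋃ Q ∈ 𝒜, ((Q.comap f : Ideal R) : Set R) →
      ∃ Q ∈ 𝒜, (S : Set R) ⊆ ((Q.comap f : Ideal R) : Set R) := by
  intro S hS _ hsub
  have key : ∀ s ∈ S, ∃ Q ∈ 𝒜, f s ∈ Q := by
    intro s hs
    have := hsub hs
    simpa using this
  by_cases h1 : (1 : T) ∈ S.map f.toAddMonoidHom
  · obtain ⟨s, hs, hs1⟩ := h1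
    obtain ⟨Q, hQ, hsQ⟩ := key s hs
    have hs2 : f s = 1 := hs1
    rw [hs2] at hsQ
    refine ⟨Q, hQ, fun x _ => ?_⟩
    rw [(Ideal.eq_top_iff_one Q).2 hsQ]
    trivial
  · obtain ⟨Q, hQ, hSQ⟩ := h (S.map f.toAddMonoidHom) (by
      rintro _ ⟨a, ha, rfl⟩ _ ⟨b, hb, rfl⟩
      exact ⟨a * b, hS a ha b hb, map_mul f a b⟩) h1 (by
      rintro _ ⟨a, ha, rfl⟩
      obtain ⟨Q, hQ, haQ⟩ := key a ha
      exact Set.mem_biUnion hQ haQ)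
    exact ⟨Q, hQ, fun x hx => hSQ ⟨x, hx, rfl⟩⟩
end

section
/- Let R be a commutative ring admitting an uncountable family {t_α} of elements such that t_α − t_β is a unit of R whenever α ≠ β. If 𝒜 is a countable subset of Spec(R), then 𝒜 has the prime avoidance property for R if and only if 𝒜 is compact in the Zariski topology. -/
/-- if `R` contains an uncountable family of elements whose pairwise
differences are units, then a countable `𝒜 ⊆ Spec R` has the prime avoidance property
for `R` iff `𝒜` is compact. -/
theorem countable_prime_avoidance_iff_compact
    {R : Type*} [CommRing R]
    (hT : ∃ T : Set R, ¬ T.Countable ∧ ∀ a ∈ T, ∀ b ∈ T, a ≠ b → IsUnit (a - b))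
    (𝒜 : Set (PrimeSpectrum R)) (h𝒜 : 𝒜.Countable) :
    (∀ I : Ideal R, (I : Set R) ⊆ ⋃ P ∈ 𝒜, (P.asIdeal : Set R) →
        ∃ P ∈ 𝒜, I ≤ P.asIdeal) ↔ IsCompact 𝒜 := by
  constructor
  · intro h
    rw [isCompact_iff_finite_subcover]
    intro ι U hU hc
    have hW : IsOpen (⋃ i, U i) := isOpen_iUnion hU
    have key : ∃ f ∈ PrimeSpectrum.vanishingIdeal (⋃ i, U i)ᶜ, ∀ P ∈ 𝒜, f ∉ P.asIdeal := by
      by_contra! hcon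
      obtain ⟨P, hP, hle⟩ := h (PrimeSpectrum.vanishingIdeal (⋃ i, U i)ᶜ) (by
        intro f hf
        obtain ⟨P, hP, hfP⟩ := hcon f hf
        exact Set.mem_biUnion hP hfP)
      have h1 : P ∈ PrimeSpectrum.zeroLocus
          (PrimeSpectrum.vanishingIdeal (⋃ i, U i)ᶜ : Set R) := hle
      rw [PrimeSpectrum.zeroLocus_vanishingIdeal_eq_closure, hW.isClosed_compl.closure_eq] at h1
      exact h1 (hc hP)
    obtain ⟨f, hf, hfA⟩ := key
    obtain ⟨t, ht⟩ := (PrimeSpectrum.isCompact_basicOpen f).elim_finite_subcover U hU (by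
      intro P hP
      by_contra hn
      exact hP ((PrimeSpectrum.mem_vanishingIdeal _ _).1 hf P hn))
    exact ⟨t, fun P hP => ht (hfA P hP)⟩
  · intro hK I hI
    obtain ⟨T, hTc, hTu⟩ := hT
    by_contra! hcon
    have key : ∃ c ∈ I, ∀ P ∈ 𝒜, P ∈ 𝒜 → c ∉ P.asIdeal := by
      refine hK.induction_on (p := fun s => ∃ c ∈ I, ∀ P ∈ s, P ∈ 𝒜 → c ∉ P.asIdeal)
        ⟨0, I.zero_mem, by simp⟩ ?_ ?_ ?_
      · rintro s t hst ⟨c, hc, h⟩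
        exact ⟨c, hc, fun P hP => h P (hst hP)⟩
      · rintro s t ⟨a, ha, hsa⟩ ⟨b, hb, htb⟩
        by_contra! hno
        apply hTc
        have hsub : T ⊆ ⋃ P ∈ 𝒜, {x | x ∈ T ∧ P ∈ s ∪ t ∧ a + x * b ∈ P.asIdeal} := by
          intro x hx
          obtain ⟨P, hP, hPA, hm⟩ := hno (a + x * b) (I.add_mem ha (I.mul_mem_left x hb))
          exact Set.mem_biUnion hPA ⟨hx, hP, hm⟩
        refine (h𝒜.biUnion fun P hPA => Set.Subsingleton.countable ?_).mono hsub
        rintro x ⟨hx, hP, hxm⟩ y ⟨hy, -, hym⟩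
        by_contra hne
        have hu := hTu x hx y hy hne
        have h1 : (x - y) * b ∈ P.asIdeal := by
          have := P.asIdeal.sub_mem hxm hym
          rwa [show a + x * b - (a + y * b) = (x - y) * b by ring] at this
        have hbP : b ∈ P.asIdeal := (Ideal.unit_mul_mem_iff_mem _ hu).1 h1
        have haP : a ∈ P.asIdeal :=
          (P.asIdeal.add_mem_iff_left (P.asIdeal.mul_mem_left x hbP)).1 hxm
        rcases hP with hP | hP
        · exact hsa P hP hPA haP
        · exact htb P hP hPA hbP
      · intro P hP
        obtain ⟨f, hf, hfP⟩ := SetLike.not_le_iff_exists.1 (hcon P hP)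
        exact ⟨PrimeSpectrum.basicOpen f,
          mem_nhdsWithin_of_mem_nhds ((PrimeSpectrum.basicOpen f).isOpen.mem_nhds hfP),
          f, hf, fun Q hQ _ => hQ⟩
    obtain ⟨c, hc, h⟩ := key
    obtain ⟨P, hP, hcP⟩ := Set.mem_iUnion₂.1 (hI hc)
    exact h P hP hP hcP
end

section
/- Let R be a commutative Bezout ring (every finitely generated ideal of R is principal) and let 𝒜 ⊆ Spec(R). Then 𝒜 has the prime avoidance property for R if and only if 𝒜 is compact in the Zariski topology. -/
/-- over a Bezout ring (every finitely generated ideal is principal),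
`𝒜 ⊆ Spec R` has the prime avoidance property for `R` iff `𝒜` is compact. -/
theorem bezout_prime_avoidance_iff_compact
    {R : Type*} [CommRing R] [IsBezout R] (𝒜 : Set (PrimeSpectrum R)) :
    (∀ I : Ideal R, (I : Set R) ⊆ ⋃ P ∈ 𝒜, (P.asIdeal : Set R) →
        ∃ P ∈ 𝒜, I ≤ P.asIdeal) ↔ IsCompact 𝒜 := by
  constructor
  · intro h
    apply isCompact_of_finite_subcover
    intro ι U hU hcov
    have h1 : ∀ i, ∃ J : Ideal R, ∀ P : PrimeSpectrum R, P ∈ U i ↔ ¬ J ≤ P.asIdeal := by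
      intro i
      obtain ⟨J, hJ⟩ := (PrimeSpectrum.isClosed_iff_zeroLocus_ideal _).1 (hU i).isClosed_compl
      refine ⟨J, fun P => ?_⟩
      have h2 : P ∈ (U i)ᶜ ↔ J ≤ P.asIdeal := by
        rw [hJ]; exact Iff.rfl
      rw [← h2]; simp
    choose J hJ using h1
    have h3 : ¬ ((⨆ i, J i : Ideal R) : Set R) ⊆ ⋃ P ∈ 𝒜, (P.asIdeal : Set R) := by
      intro h4
      obtain ⟨P, hP, hle⟩ := h _ h4
      obtain ⟨i, hi⟩ := Set.mem_iUnion.1 (hcov hP)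
      exact (hJ i P).1 hi ((le_iSup J i).trans hle)
    obtain ⟨x, hx, hx'⟩ := Set.not_subset.1 h3
    obtain ⟨t, ht⟩ := Submodule.mem_iSup_iff_exists_finset.1 hx
    refine ⟨t, fun P hP => ?_⟩
    by_contra hc
    apply hx'
    refine Set.mem_biUnion hP ?_
    have h5 : (⨆ i ∈ t, J i) ≤ P.asIdeal := by
      refine iSup₂_le fun i hi => ?_
      by_contra hn
      exact hc (Set.mem_biUnion hi ((hJ i P).2 hn))
    exact h5 ht
  · intro hc I hI
    by_contra! hn
    obtain ⟨t, ht⟩ := hc.elim_finite_subcover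
      (fun f : I => (PrimeSpectrum.basicOpen (f : R) : Set (PrimeSpectrum R)))
      (fun f => (PrimeSpectrum.basicOpen (f : R)).isOpen) (by
        intro P hP
        obtain ⟨f, hf, hf'⟩ := SetLike.not_le_iff_exists.1 (hn P hP)
        exact Set.mem_iUnion.2 ⟨⟨f, hf⟩, hf'⟩)
    have hfg : (Ideal.span ((fun f : I => (f : R)) '' (t : Set I))).FG :=
      Submodule.fg_span (t.finite_toSet.image _)
    obtain ⟨g, hg⟩ := (IsBezout.isPrincipal_of_FG _ hfg).principal
    have hgI : g ∈ I := by
      have h1 : Ideal.span ((fun f : I => (f : R)) '' (t : Set I)) ≤ I := by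
        rw [Ideal.span_le]
        rintro _ ⟨f, -, rfl⟩
        exact f.2
      apply h1
      rw [hg]
      exact Submodule.mem_span_singleton_self g
    obtain ⟨P, hP, hgP⟩ := Set.mem_iUnion₂.1 (hI hgI)
    obtain ⟨f, hf, hfP⟩ := Set.mem_iUnion₂.1 (ht hP)
    apply hfP
    have h2 : Ideal.span ((fun f : I => (f : R)) '' (t : Set I)) ≤ P.asIdeal := by
      rw [hg]
      exact (Ideal.span_singleton_le_iff_mem _).2 hgP
    exact h2 (Ideal.subset_span ⟨f, hf, rfl⟩)
end

section
/- Let R be a Prüfer domain (an integral domain in which every nonzero finitely generated ideal is invertible as a fractional ideal) with quotient field K, and let T be an overring of R, i.e., a subring of K containing R. Then the set 𝒜 = { P ∈ Spec(R) : the ideal PT generated by (the image of) P in T is a maximal ideal of T } is compact in the Zariski topology on Spec(R). -/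
/-- if `R` is a Prüfer domain with quotient field `K` (every nonzero
finitely generated ideal is invertible as a fractional ideal) and `T` is an overring
of `R` (a subring of `K` containing `R`, formalized as an `R`-subalgebra of `K`), then
the set of primes `P` of `R` such that `PT` is a maximal ideal of `T` is compact in
the Zariski topology. -/
theorem prufer_maximal_extension_set_isCompact
    {R : Type*} [CommRing R] [IsDomain R]
    {K : Type*} [Field K] [Algebra R K] [IsFractionRing R K]
    (hPrufer : ∀ I : Ideal R, I ≠ ⊥ → I.FG →
      ∃ J : FractionalIdeal (nonZeroDivisors R) K,
        (I : FractionalIdeal (nonZeroDivisors R) K) * J = 1)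
    (T : Subalgebra R K) :
    IsCompact {P : PrimeSpectrum R | (P.asIdeal.map (algebraMap R T)).IsMaximal} := by
  classical
  have key : ∀ a b : R, b ≠ 0 → ∃ x y : K, ∃ p q r s : R,
      algebraMap R K a * x + algebraMap R K b * y = 1 ∧
      algebraMap R K p = algebraMap R K a * x ∧ algebraMap R K q = algebraMap R K b * x ∧
      algebraMap R K r = algebraMap R K a * y ∧ algebraMap R K s = algebraMap R K b * y := by
    intro a b hb
    have ha' : a ∈ Ideal.span {a, b} := Ideal.subset_span (by simp)
    have hb' : b ∈ Ideal.span {a, b} := Ideal.subset_span (by simp)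
    obtain ⟨J, hJ⟩ := hPrufer (Ideal.span {a, b})
      (fun h => hb (by rw [h] at hb'; simpa using hb')) ⟨{a, b}, by simp⟩
    have hm : ∀ c ∈ Ideal.span {a, b}, ∀ x ∈ J, ∃ p : R,
        algebraMap R K p = algebraMap R K c * x := by
      intro c hc x hx
      have h1 : algebraMap R K c * x ∈ (1 : FractionalIdeal (nonZeroDivisors R) K) := by
        rw [← hJ]
        exact FractionalIdeal.mul_mem_mul (FractionalIdeal.mem_coeIdeal_of_mem _ hc) hx
      exact (FractionalIdeal.mem_one_iff _).1 h1
    have h1 : (1 : K) ∈ (1 : FractionalIdeal (nonZeroDivisors R) K) :=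
      FractionalIdeal.one_mem_one _
    rw [← hJ, Ideal.span_insert, FractionalIdeal.coeIdeal_sup, ← FractionalIdeal.sup_eq_add,
      FractionalIdeal.sup_eq_add, add_mul, FractionalIdeal.mem_add] at h1
    obtain ⟨u, hu, v, hv, huv⟩ := h1
    rw [FractionalIdeal.coeIdeal_span_singleton, FractionalIdeal.mem_singleton_mul] at hu hv
    obtain ⟨x, hx, rfl⟩ := hu
    obtain ⟨y, hy, rfl⟩ := hv
    obtain ⟨p, hp⟩ := hm a ha' x hx
    obtain ⟨q, hq⟩ := hm b hb' x hx
    obtain ⟨r, hr⟩ := hm a ha' y hy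
    obtain ⟨s, hs⟩ := hm b hb' y hy
    exact ⟨x, y, p, q, r, s, huv, hp, hq, hr, hs⟩
  have ext : ∀ M : Ideal T, (M.comap (algebraMap R T)).map (algebraMap R T) = M := by
    intro M
    refine le_antisymm Ideal.map_comap_le fun t ht => ?_
    obtain ⟨a, b, hb, hab⟩ := IsFractionRing.div_surjective (A := R) (t : K)
    have hb0 : b ≠ 0 := nonZeroDivisors.ne_zero hb
    have hbK : algebraMap R K b ≠ 0 := by
      simpa using hb0
    have hta : (t : K) * algebraMap R K b = algebraMap R K a := by
      rw [← hab]; field_simp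
    obtain ⟨x, y, p, q, r, s, h1, hp, hq, hr, hs⟩ := key a b hb0
    have e1 : algebraMap R T p = algebraMap R T q * t := by
      apply Subtype.ext
      change algebraMap R K p = algebraMap R K q * t
      rw [hp, hq, ← hta]; ring
    have e2 : algebraMap R T r = algebraMap R T s * t := by
      apply Subtype.ext
      change algebraMap R K r = algebraMap R K s * t
      rw [hr, hs, ← hta]; ring
    have e3 : t = t * algebraMap R T p + algebraMap R T r := by
      apply Subtype.ext
      change (t : K) = t * algebraMap R K p + algebraMap R K r
      rw [hp, hr]
      linear_combination (-(t : K)) * h1 + y * hta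
    have mp : p ∈ M.comap (algebraMap R T) := by
      rw [Ideal.mem_comap, e1]; exact M.mul_mem_left _ ht
    have mr : r ∈ M.comap (algebraMap R T) := by
      rw [Ideal.mem_comap, e2]; exact M.mul_mem_left _ ht
    rw [e3]
    exact Ideal.add_mem _ (Ideal.mul_mem_left _ _ (Ideal.mem_map_of_mem _ mp))
      (Ideal.mem_map_of_mem _ mr)
  rw [isCompact_iff_finite_subcover]
  intro ι U hU hcov
  let f := PrimeSpectrum.comap (algebraMap R T)
  have hf : Continuous f := PrimeSpectrum.continuous_comap _
  have hcovT : (Set.univ : Set (PrimeSpectrum T)) ⊆ ⋃ i, f ⁻¹' U i := by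
    intro N _
    obtain ⟨M, hM, hNM⟩ := Ideal.exists_le_maximal N.asIdeal N.isPrime.ne_top
    let M' : PrimeSpectrum T := ⟨M, hM.isPrime⟩
    have hA : f M' ∈ {P : PrimeSpectrum R | (P.asIdeal.map (algebraMap R T)).IsMaximal} := by
      change ((M.comap (algebraMap R T)).map (algebraMap R T)).IsMaximal
      rw [ext]; exact hM
    obtain ⟨i, hi⟩ := Set.mem_iUnion.1 (hcov hA)
    refine Set.mem_iUnion.2 ⟨i, ?_⟩
    have hs : N ⤳ M' := (PrimeSpectrum.le_iff_specializes N M').1 hNM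
    exact hs.mem_open ((hU i).preimage hf) hi
  obtain ⟨t, ht⟩ := isCompact_univ.elim_finite_subcover _ (fun i => (hU i).preimage hf) hcovT
  refine ⟨t, fun P hP => ?_⟩
  let M' : PrimeSpectrum T := ⟨_, Ideal.IsMaximal.isPrime hP⟩
  have hs : P ⤳ f M' := (PrimeSpectrum.le_iff_specializes P (f M')).1 Ideal.le_comap_map
  have := ht (Set.mem_univ M')
  simp only [Set.mem_iUnion, Set.mem_preimage] at this ⊢
  obtain ⟨i, hi, h⟩ := this
  exact ⟨i, hi, hs.mem_open (hU i) h⟩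
end

section
/- Let R be a QR-domain, i.e., an integral domain with quotient field K such that every subring T with R ⊆ T ⊆ K is a localization of R at some multiplicatively closed subset of R. Then a subset 𝒜 ⊆ Spec(R) has the prime avoidance property for R if and only if 𝒜 is compact in the Zariski topology. -/
theorem qr_common_denom {R K : Type*} [CommRing R] [Field K] [Algebra R K]
    (T : Subalgebra R K) (S : Submonoid R) [IsLocalization S T] (y z : K)
    (hy : y ∈ T) (hz : z ∈ T) :
    ∃ p q s : R, (∃ w ∈ T, w * algebraMap R K s = 1) ∧
      y * algebraMap R K s = algebraMap R K p ∧ z * algebraMap R K s = algebraMap R K q := by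
  obtain ⟨⟨p, s⟩, hp⟩ := IsLocalization.surj S (⟨y, hy⟩ : T)
  obtain ⟨⟨q, t⟩, hq⟩ := IsLocalization.surj S (⟨z, hz⟩ : T)
  have hp' : y * algebraMap R K s = algebraMap R K p := congrArg Subtype.val hp
  have hq' : z * algebraMap R K t = algebraMap R K q := congrArg Subtype.val hq
  obtain ⟨w, hw⟩ := (IsLocalization.map_units T (s * t)).exists_left_inv
  refine ⟨p * t, q * s, (s * t : S), ⟨w, w.2, congrArg Subtype.val hw⟩, ?_, ?_⟩
  · simp only [Submonoid.coe_mul, map_mul]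
    rw [← mul_assoc, hp']
  · simp only [Submonoid.coe_mul, map_mul]
    rw [← hq']; ring

theorem qr_integral {R : Type*} [CommRing R] [IsDomain R]
    {K : Type*} [Field K] [Algebra R K] [IsFractionRing R K]
    (hQR : ∀ T : Subalgebra R K, ∃ S : Submonoid R, IsLocalization S T)
    (x : K) (hx : IsIntegral R x) : ∃ r, algebraMap R K r = x := by
  obtain ⟨S, hS⟩ := hQR (Algebra.adjoin R {x})
  obtain ⟨p, q, s, ⟨w, hw, hws⟩, hp, -⟩ := qr_common_denom _ S x x
    (Algebra.self_mem_adjoin_singleton R x) (Algebra.self_mem_adjoin_singleton R x)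
  have : Algebra.IsIntegral R (Algebra.adjoin R {x}) :=
    Algebra.IsIntegral.adjoin (by rintro y rfl; exact hx)
  have hu : IsUnit (algebraMap R (Algebra.adjoin R {x}) s) :=
    IsUnit.of_mul_eq_one_right ⟨w, hw⟩ (Subtype.ext hws)
  have hu' : IsUnit s := isUnit_of_map_unit _ _ hu
  obtain ⟨t, ht⟩ := hu'.exists_right_inv
  refine ⟨p * t, ?_⟩
  rw [map_mul, ← hp, mul_assoc, ← map_mul, ht, map_one, mul_one]

theorem qr_split {R : Type*} [CommRing R] [IsDomain R]
    {K : Type*} [Field K] [Algebra R K] [IsFractionRing R K]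
    (hQR : ∀ T : Subalgebra R K, ∃ S : Submonoid R, IsLocalization S T)
    (x : K) (hx : x ≠ 0) : ∃ c r t : R, algebraMap R K c * x = algebraMap R K r ∧
      algebraMap R K (1 - c) * x⁻¹ = algebraMap R K t := by
  obtain ⟨S, hS⟩ := hQR (Algebra.adjoin R {x})
  obtain ⟨p, q, s, ⟨w, hw, hws⟩, hp, -⟩ := qr_common_denom _ S x x
    (Algebra.self_mem_adjoin_singleton R x) (Algebra.self_mem_adjoin_singleton R x)
  rw [Algebra.adjoin_singleton_eq_range_aeval] at hw
  obtain ⟨f, hf⟩ := hw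
  replace hf : Polynomial.aeval x f = w := hf
  set g : Polynomial R := 1 - Polynomial.C s * f with hg
  have hg0 : Polynomial.aeval x g = 0 := by
    simp [hg, hf, mul_comm _ w, hws]
  have hgc : g.coeff 0 = 1 - s * f.coeff 0 := by simp [hg]
  have hint : ∃ t, algebraMap R K t = algebraMap R K (1 - s * f.coeff 0) * x⁻¹ := by
    by_cases h0 : g.coeff 0 = 0
    · exact ⟨0, by rw [← hgc, h0]; simp⟩
    · apply qr_integral hQR
      letI := invertibleOfNonzero hx
      have h1 : Polynomial.aeval x⁻¹ g.reverse = 0 := by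
        have := (Polynomial.eval₂_reverse_eq_zero_iff (algebraMap R K) x g).2 hg0
        rwa [invOf_eq_inv] at this
      have h2 := isIntegral_leadingCoeff_smul _ _ h1
      rwa [Polynomial.reverse_leadingCoeff, Polynomial.trailingCoeff_eq_coeff_zero h0,
        hgc, Algebra.smul_def] at h2
  obtain ⟨t, ht⟩ := hint
  refine ⟨s * f.coeff 0, p * f.coeff 0, t, ?_, ht.symm⟩
  rw [map_mul, map_mul, ← hp]; ring

theorem qr_pow_mem {R K : Type*} [CommRing R] [Field K] [Algebra R K]
    (a : R) (X : Set K) (hX : ∀ x ∈ X, ∃ r, algebraMap R K a * x = algebraMap R K r)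
    (y : K) (hy : y ∈ Algebra.adjoin R X) :
    ∃ (n : ℕ) (r : R), algebraMap R K a ^ n * y = algebraMap R K r := by
  induction hy using Algebra.adjoin_induction with
  | mem x hx => obtain ⟨r, hr⟩ := hX x hx; exact ⟨1, r, by rw [pow_one, hr]⟩
  | algebraMap r => exact ⟨0, r, by simp⟩
  | add x y _ _ h1 h2 =>
    obtain ⟨n, r, h1⟩ := h1
    obtain ⟨m, t, h2⟩ := h2
    refine ⟨n + m, a ^ m * r + a ^ n * t, ?_⟩
    rw [map_add, map_mul, map_mul, ← h1, ← h2, map_pow, map_pow]; ring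
  | mul x y _ _ h1 h2 =>
    obtain ⟨n, r, h1⟩ := h1
    obtain ⟨m, t, h2⟩ := h2
    refine ⟨n + m, r * t, ?_⟩
    rw [map_mul, ← h1, ← h2]; ring

theorem qr_two {R : Type*} [CommRing R] [IsDomain R]
    {K : Type*} [Field K] [Algebra R K] [IsFractionRing R K]
    (hQR : ∀ T : Subalgebra R K, ∃ S : Submonoid R, IsLocalization S T)
    (a b : R) : ∃ f : R, (∃ p q, f = p * a + q * b) ∧ (∃ n : ℕ, f ∣ a ^ n) ∧
      ∃ n : ℕ, f ∣ b ^ n := by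
  by_cases ha : a = 0
  · exact ⟨b, ⟨0, 1, by simp⟩, ⟨1, by simp [ha]⟩, ⟨1, by simp⟩⟩
  by_cases hb : b = 0
  · exact ⟨a, ⟨1, 0, by simp⟩, ⟨1, by simp⟩, ⟨1, by simp [hb]⟩⟩
  have inj := IsFractionRing.injective R K
  have ha' : algebraMap R K a ≠ 0 := by simpa using ha
  have hb' : algebraMap R K b ≠ 0 := by simpa using hb
  obtain ⟨c, r, t, hr, ht⟩ := qr_split hQR (algebraMap R K a / algebraMap R K b)
    (div_ne_zero ha' hb')
  set u : K := algebraMap R K (1 - c) / algebraMap R K a with hu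
  set v : K := algebraMap R K c / algebraMap R K b with hv
  have hua : algebraMap R K a * u = algebraMap R K (1 - c) := by rw [hu]; field_simp
  have hvb : algebraMap R K b * v = algebraMap R K c := by rw [hv]; field_simp
  have hub : algebraMap R K b * u = algebraMap R K t := by rw [← ht, hu, inv_div]; ring
  have hva : algebraMap R K a * v = algebraMap R K r := by rw [← hr, hv]; ring
  obtain ⟨S, hS⟩ := hQR (Algebra.adjoin R {u, v})
  obtain ⟨p, q, s, ⟨w, hw, hws⟩, hp, hq⟩ := qr_common_denom _ S u v
    (Algebra.subset_adjoin (Set.mem_insert u {v}))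
    (Algebra.subset_adjoin (Set.mem_insert_of_mem u (Set.mem_singleton v)))
  have key : ∀ (d : R), (∀ x ∈ ({u, v} : Set K), ∃ r, algebraMap R K d * x = algebraMap R K r) →
      ∃ n : ℕ, s ∣ d ^ n := by
    intro d hd
    obtain ⟨n, e, he⟩ := qr_pow_mem d _ hd w hw
    refine ⟨n, e, inj ?_⟩
    rw [map_mul, ← he, map_pow]
    linear_combination (-(algebraMap R K d) ^ n) * hws
  refine ⟨s, ⟨p, q, inj ?_⟩, key a ?_, key b ?_⟩
  · rw [map_add, map_mul, map_mul, ← hp, ← hq]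
    rw [map_sub, map_one] at hua
    linear_combination (-algebraMap R K s) * (hua + hvb)
  · rintro x (rfl | rfl)
    exacts [⟨_, hua⟩, ⟨_, hva⟩]
  · rintro x (rfl | rfl)
    exacts [⟨_, hub⟩, ⟨_, hvb⟩]

theorem qr_finset {R : Type*} [CommRing R] [IsDomain R]
    {K : Type*} [Field K] [Algebra R K] [IsFractionRing R K]
    (hQR : ∀ T : Subalgebra R K, ∃ S : Submonoid R, IsLocalization S T)
    (I : Ideal R) (t : Finset I) :
    ∃ f ∈ I, ∀ x ∈ t, ∃ n : ℕ, f ∣ (x : R) ^ n := by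
  classical
  induction t using Finset.induction_on with
  | empty => exact ⟨0, I.zero_mem, by simp⟩
  | insert a t _ ih =>
    obtain ⟨f, hf, h⟩ := ih
    obtain ⟨g, ⟨p, q, hg⟩, ⟨n, hn⟩, ⟨m, hm⟩⟩ := qr_two hQR (a : R) f
    refine ⟨g, ?_, ?_⟩
    · rw [hg]; exact I.add_mem (I.mul_mem_left _ a.2) (I.mul_mem_left _ hf)
    · intro x hx
      rcases Finset.mem_insert.1 hx with rfl | hx
      · exact ⟨n, hn⟩
      · obtain ⟨k, hk⟩ := h x hx
        exact ⟨k * m, hm.trans (by rw [pow_mul]; exact pow_dvd_pow_of_dvd hk m)⟩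

/-- over a QR-domain (an integral domain each of whose overrings is a
localization at a multiplicatively closed subset), `𝒜 ⊆ Spec R` has the prime
avoidance property for `R` iff `𝒜` is compact in the Zariski topology. -/
theorem qr_domain_prime_avoidance_iff_compact
    {R : Type*} [CommRing R] [IsDomain R]
    {K : Type*} [Field K] [Algebra R K] [IsFractionRing R K]
    (hQR : ∀ T : Subalgebra R K, ∃ S : Submonoid R, IsLocalization S T)
    (𝒜 : Set (PrimeSpectrum R)) :
    (∀ I : Ideal R, (I : Set R) ⊆ ⋃ P ∈ 𝒜, (P.asIdeal : Set R) →
        ∃ P ∈ 𝒜, I ≤ P.asIdeal) ↔ IsCompact 𝒜 := by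
  constructor
  · intro h
    refine isCompact_of_finite_subcover ?_
    intro ι U hU hcov
    obtain ⟨f, hfI, hf⟩ : ∃ f ∈ (⨆ i, PrimeSpectrum.vanishingIdeal (U i)ᶜ),
        ∀ P ∈ 𝒜, f ∉ P.asIdeal := by
      by_contra! hcon
      obtain ⟨P, hP, hle⟩ := h (⨆ i, PrimeSpectrum.vanishingIdeal (U i)ᶜ) (by
        intro f hf
        obtain ⟨P, hP, hfP⟩ := hcon f hf
        exact Set.mem_biUnion hP hfP)
      obtain ⟨i, hi⟩ := Set.mem_iUnion.1 (hcov hP)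
      have h1 : P ∈ PrimeSpectrum.zeroLocus
          (PrimeSpectrum.vanishingIdeal (U i)ᶜ : Set R) := (le_iSup _ i).trans hle
      rw [PrimeSpectrum.zeroLocus_vanishingIdeal_eq_closure,
        (hU i).isClosed_compl.closure_eq] at h1
      exact h1 hi
    obtain ⟨t, ht⟩ := Submodule.exists_finset_of_mem_iSup _ hfI
    refine ⟨t, fun P hP => ?_⟩
    by_contra hn
    simp only [Set.mem_iUnion, not_exists] at hn
    refine hf P hP ?_
    have hle : (⨆ i ∈ t, PrimeSpectrum.vanishingIdeal (U i)ᶜ) ≤ P.asIdeal := by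
      refine iSup₂_le fun i hi g hg => ?_
      exact (PrimeSpectrum.mem_vanishingIdeal _ _).1 hg P (hn i hi)
    exact hle ht
  · intro hc I hI
    by_contra! hcon
    obtain ⟨t, ht⟩ := hc.elim_finite_subcover
      (fun f : I => (PrimeSpectrum.basicOpen (f : R) : Set (PrimeSpectrum R)))
      (fun f => (PrimeSpectrum.basicOpen (f : R)).isOpen) (by
        intro P hP
        obtain ⟨f, hf, hfP⟩ := SetLike.not_le_iff_exists.1 (hcon P hP)
        exact Set.mem_iUnion.2 ⟨⟨f, hf⟩, hfP⟩)
    obtain ⟨f, hf, h⟩ := qr_finset hQR I t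
    obtain ⟨P, hP, hfP⟩ := Set.mem_iUnion₂.1 (hI hf)
    obtain ⟨x, hx, hxP⟩ := Set.mem_iUnion₂.1 (ht hP)
    obtain ⟨n, hn⟩ := h x hx
    exact hxP (P.2.mem_of_pow_mem n (P.asIdeal.mem_of_dvd hn hfP))
end

section
/- Let R be a commutative ring, 𝒜 ⊆ Spec(R), I an ideal of R, a ∈ R, and Q₁, …, Q_n prime ideals of R. Write V_𝒜(a) = { P ∈ 𝒜 : a ∈ P }. Suppose Ra + I ⊄ (⋃_{P ∈ V_𝒜(a)} P) ∪ Q₁ ∪ ⋯ ∪ Q_n and suppose V_𝒜(a) has the prime avoidance property for R. Then there exists c ∈ I such that a + c ∉ (⋃_{P ∈ V_𝒜(a)} P) ∪ Q₁ ∪ ⋯ ∪ Q_n. -/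
theorem davis_finite_aux {R : Type*} [CommRing R] {ι : Type*} (Q : ι → Ideal R)
    (hQ : ∀ i, (Q i).IsPrime) (u v : R) (h : ∀ i, u ∈ Q i → v ∉ Q i) (s : Finset ι) :
    ∃ k : R, ∀ i ∈ s, u + k * v ∉ Q i := by
  classical
  induction s using Finset.induction_on with
  | empty => exact ⟨0, by simp⟩
  | insert i s _ ih =>
    obtain ⟨k, hk⟩ := ih
    by_cases hi : u + k * v ∈ Q i
    · have hv : v ∉ Q i := by
        intro hv
        exact h i (((Q i).add_mem_iff_left ((Q i).mul_mem_left k hv)).1 hi) hv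
      have hm : ¬ (s.filter (fun j => ¬ Q j ≤ Q i)).inf Q ≤ Q i := by
        intro hle
        obtain ⟨j, hj, hji⟩ := ((hQ i).inf_le').1 hle
        exact (Finset.mem_filter.1 hj).2 hji
      obtain ⟨m, hm1, hm2⟩ := SetLike.not_le_iff_exists.1 hm
      have e : u + (k + m) * v = (u + k * v) + m * v := by ring
      have hni : u + (k + m) * v ∉ Q i := by
        rw [e]
        intro hc
        rcases (hQ i).mem_or_mem (((Q i).add_mem_iff_right hi).1 hc) with h1 | h1
        · exact hm2 h1
        · exact hv h1
      refine ⟨k + m, fun j hj => ?_⟩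
      rcases Finset.mem_insert.1 hj with rfl | hj
      · exact hni
      · by_cases hji : Q j ≤ Q i
        · exact fun hc => hni (hji hc)
        · have hmj : m ∈ Q j :=
            (Finset.inf_le (f := Q) (Finset.mem_filter.2 ⟨hj, hji⟩)) hm1
          rw [e]
          intro hc
          exact hk j hj (((Q j).add_mem_iff_left ((Q j).mul_mem_right v hmj)).1 hc)
    · refine ⟨k, fun j hj => ?_⟩
      rcases Finset.mem_insert.1 hj with rfl | hj
      · exact hi
      · exact hk j hj

/-- Davis-type avoidance. If `Ra + I` is not contained in
`(⋃_{P ∈ V_𝒜(a)} P) ∪ Q₁ ∪ ⋯ ∪ Q_n` and `V_𝒜(a) = {P ∈ 𝒜 | a ∈ P}` has the prime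
avoidance property for `R`, then there is `c ∈ I` with
`a + c ∉ (⋃_{P ∈ V_𝒜(a)} P) ∪ Q₁ ∪ ⋯ ∪ Q_n`. -/
theorem davis_avoidance
    {R : Type*} [CommRing R] (𝒜 : Set (PrimeSpectrum R)) (I : Ideal R) (a : R)
    {n : ℕ} (Q : Fin n → Ideal R) (hQ : ∀ i, (Q i).IsPrime)
    (hPA : ∀ J : Ideal R,
      (J : Set R) ⊆ ⋃ P ∈ {P ∈ 𝒜 | a ∈ P.asIdeal}, (P.asIdeal : Set R) →
        ∃ P ∈ {P ∈ 𝒜 | a ∈ P.asIdeal}, J ≤ P.asIdeal)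
    (hcov : ¬ ((Ideal.span {a} ⊔ I : Ideal R) : Set R) ⊆
        (⋃ P ∈ {P ∈ 𝒜 | a ∈ P.asIdeal}, (P.asIdeal : Set R)) ∪ ⋃ i, (Q i : Set R)) :
    ∃ c ∈ I, a + c ∉
      (⋃ P ∈ {P ∈ 𝒜 | a ∈ P.asIdeal}, (P.asIdeal : Set R)) ∪ ⋃ i, (Q i : Set R) := by
  obtain ⟨x, hx, hxn⟩ := Set.not_subset.1 hcov
  obtain ⟨y, hy, b, hb, rfl⟩ := Submodule.mem_sup.1 hx
  obtain ⟨r, rfl⟩ := Ideal.mem_span_singleton'.1 hy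
  simp only [Set.mem_union, Set.mem_iUnion, SetLike.mem_coe, not_or, not_exists,
    Set.mem_setOf_eq] at hxn ⊢
  obtain ⟨h1, h2⟩ := hxn
  have hab : ∀ i, a ∈ Q i → b ∉ Q i := fun i ha hb' =>
    h2 i ((Q i).add_mem ((Q i).mul_mem_left r ha) hb')
  obtain ⟨k, hk⟩ := davis_finite_aux Q hQ (a + b) (a * b) (fun i hs hp => by
    rcases (hQ i).mem_or_mem hp with h | h
    · exact hab i h (((Q i).add_mem_iff_right h).1 hs)
    · exact hab i (((Q i).add_mem_iff_left h).1 hs) h) Finset.univ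
  refine ⟨b + k * (a * b), I.add_mem hb (I.mul_mem_left _ (I.mul_mem_left _ hb)), ?_, ?_⟩
  · intro P hP hc
    refine h1 P hP (P.asIdeal.add_mem (P.asIdeal.mul_mem_left r hP.2) ?_)
    have hc' := (P.asIdeal.add_mem_iff_right hP.2).1 hc
    exact (P.asIdeal.add_mem_iff_left
      (P.asIdeal.mul_mem_left k (P.asIdeal.mul_mem_right b hP.2))).1 hc'
  · intro i hc
    rw [← add_assoc] at hc
    exact hk i (Finset.mem_univ i) hc
end

section
/- Let R be an integral domain. Then R is a principal ideal domain if and only if R is a unique factorization domain and the family of all principal prime ideals of R (the set of prime ideals of R that are principal) has the prime avoidance property for R. -/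
/-- an integral domain `R` is a PID iff `R` is a UFD and the family of
all principal prime ideals of `R` has the prime avoidance property for `R`. -/
theorem pid_iff_ufd_and_principal_prime_avoidance
    {R : Type*} [CommRing R] [IsDomain R] :
    IsPrincipalIdealRing R ↔
      (UniqueFactorizationMonoid R ∧
        ∀ I : Ideal R,
          (I : Set R) ⊆
            ⋃ P ∈ {P : Ideal R | P.IsPrime ∧ Submodule.IsPrincipal P}, (P : Set R) →
          ∃ P : Ideal R, P.IsPrime ∧ Submodule.IsPrincipal P ∧ I ≤ P) := by
  constructor
  · intro h
    refine ⟨inferInstance, fun I hI => ?_⟩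
    have hne : I ≠ ⊤ := by
      rintro rfl
      have h1 := hI (show (1 : R) ∈ ((⊤ : Ideal R) : Set R) from trivial)
      simp only [Set.mem_iUnion, Set.mem_setOf_eq] at h1
      obtain ⟨P, ⟨hP, -⟩, h1⟩ := h1
      exact hP.ne_top ((Ideal.eq_top_iff_one P).2 h1)
    obtain ⟨M, hM, hIM⟩ := Ideal.exists_le_maximal I hne
    exact ⟨M, hM.isPrime, h.principal M, hIM⟩
  · rintro ⟨hU, hA⟩
    refine IsPrincipalIdealRing.of_prime_ne_bot fun Q hQ hQ0 => ?_
    obtain ⟨p, hpQ, hp⟩ := hQ.exists_mem_prime_of_ne_bot hQ0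
    obtain ⟨P, hP, hPp, hQP⟩ := hA Q (by
      intro x hx
      simp only [Set.mem_iUnion, Set.mem_setOf_eq]
      by_cases hx0 : x = 0
      · exact ⟨⊥, ⟨Ideal.isPrime_bot, inferInstance⟩, by simp [hx0]⟩
      · have hxu : ¬ IsUnit x := fun hu => hQ.ne_top (Ideal.eq_top_of_isUnit_mem Q hx hu)
        obtain ⟨q, hq, hqx⟩ := WfDvdMonoid.exists_irreducible_factor hxu hx0
        have hq' : Prime q := hq.prime
        exact ⟨Ideal.span {q}, ⟨(Ideal.span_singleton_prime hq'.ne_zero).2 hq', ⟨q, rfl⟩⟩,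
          Ideal.mem_span_singleton.2 hqx⟩)
    obtain ⟨q, rfl⟩ := hPp
    have hqp : q ∣ p := Ideal.mem_span_singleton.1 (hQP hpQ)
    have hqu : ¬ IsUnit q := fun hu =>
      hP.ne_top (Ideal.eq_top_of_isUnit_mem _ (Ideal.mem_span_singleton_self q) hu)
    have hpq : p ∣ q := by
      obtain ⟨c, hc⟩ := hqp
      rcases hp.irreducible.isUnit_or_isUnit hc with hu | hu
      · exact absurd hu hqu
      · rw [hc]
        exact hu.mul_right_dvd.2 dvd_rfl
    refine ⟨q, le_antisymm hQP ?_⟩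
    exact (Ideal.span_singleton_le_iff_mem Q).2 (Q.mem_of_dvd hpq hpQ)
end

section
/- Let X be a topological space and let C(X) denote the ring of continuous real-valued functions on X. Then every subset 𝒜 ⊆ Spec(C(X)) has the prime avoidance property for finitely generated ideals: if a finitely generated ideal I of C(X) satisfies I ⊆ ⋃_{P∈𝒜} P, then I ⊆ P for some P ∈ 𝒜. Consequently, 𝒜 ⊆ Spec(C(X)) has the prime avoidance property for C(X) if and only if 𝒜 is compact in the Zariski topology. -/
theorem cX_dvd {X : Type*} [TopologicalSpace X] (f g : C(X, ℝ)) (h : ∀ x, g x ^ 2 ≤ f x) :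
    f ∣ g ^ 4 := by
  have hb : ∀ x, |g x ^ 4 / f x| ≤ f x := by
    intro x
    have h1 := h x
    have h0 : 0 ≤ g x ^ 2 := sq_nonneg _
    have h2 : 0 ≤ f x := h0.trans h1
    rw [abs_of_nonneg (by positivity)]
    refine div_le_of_le_mul₀ h2 h2 ?_
    nlinarith
  refine ⟨⟨fun x => g x ^ 4 / f x, ?_⟩, ?_⟩
  · rw [continuous_iff_continuousAt]
    intro x
    by_cases hx : f x = 0
    · have hf : Filter.Tendsto f (nhds x) (nhds 0) := by
        have := f.continuous.tendsto x
        rwa [hx] at this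
      unfold ContinuousAt
      simp only [hx, div_zero]
      exact squeeze_zero_norm (fun y => (Real.norm_eq_abs _).trans_le (hb y)) hf
    · exact ContinuousAt.div (by fun_prop) (by fun_prop) hx
  · ext x
    by_cases hx : f x = 0
    · have h1 := h x
      have : g x = 0 := by
        have : g x ^ 2 = 0 := le_antisymm (hx ▸ h1) (sq_nonneg _)
        simpa using this
      simp [hx, this]
    · simp only [ContinuousMap.coe_pow, Pi.pow_apply, ContinuousMap.mul_apply,
        ContinuousMap.coe_mk]
      field_simp

theorem cX_fg {X : Type*} [TopologicalSpace X] (𝒜 : Set (PrimeSpectrum C(X, ℝ)))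
    (I : Ideal C(X, ℝ)) (hI : I.FG)
    (h : (I : Set C(X, ℝ)) ⊆ ⋃ P ∈ 𝒜, (P.asIdeal : Set C(X, ℝ))) :
    ∃ P ∈ 𝒜, I ≤ P.asIdeal := by
  obtain ⟨s, rfl⟩ := hI
  have hm : (∑ g ∈ s, g ^ 2) ∈ Ideal.span (s : Set C(X, ℝ)) :=
    Ideal.sum_mem _ fun g hg => Ideal.pow_mem_of_mem _ (Ideal.subset_span hg) 2 (by norm_num)
  have := h hm
  simp only [Set.mem_iUnion, exists_prop] at this
  obtain ⟨P, hP, hfP⟩ := this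
  refine ⟨P, hP, Ideal.span_le.2 fun g hg => ?_⟩
  have hd : (∑ g ∈ s, g ^ 2) ∣ g ^ 4 := by
    apply cX_dvd
    intro x
    simp only [ContinuousMap.coe_sum, Finset.sum_apply, ContinuousMap.coe_pow, Pi.pow_apply]
    exact Finset.single_le_sum (f := fun k : C(X, ℝ) => k x ^ 2)
      (fun k _ => sq_nonneg (k x)) hg
  exact P.isPrime.mem_of_pow_mem 4 (P.asIdeal.mem_of_dvd hd hfP)


/-- every `𝒜 ⊆ Spec C(X)` has the prime avoidance property for finitely
generated ideals of `C(X)`; consequently `𝒜` has the prime avoidance property for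
`C(X)` iff `𝒜` is compact in the Zariski topology. -/
theorem continuousMap_ring_prime_avoidance
    {X : Type*} [TopologicalSpace X] (𝒜 : Set (PrimeSpectrum C(X, ℝ))) :
    (∀ I : Ideal C(X, ℝ), I.FG →
        (I : Set C(X, ℝ)) ⊆ ⋃ P ∈ 𝒜, (P.asIdeal : Set C(X, ℝ)) →
        ∃ P ∈ 𝒜, I ≤ P.asIdeal) ∧
      ((∀ I : Ideal C(X, ℝ),
          (I : Set C(X, ℝ)) ⊆ ⋃ P ∈ 𝒜, (P.asIdeal : Set C(X, ℝ)) →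
          ∃ P ∈ 𝒜, I ≤ P.asIdeal) ↔ IsCompact 𝒜) := by
  refine ⟨fun I => cX_fg 𝒜 I, fun H => ?_, fun hc I hI => ?_⟩
  · refine isCompact_of_finite_subfamily_closed fun {ι} t ht he => ?_
    let J : ι → Ideal C(X, ℝ) := fun i => PrimeSpectrum.vanishingIdeal (t i)
    have hJ : ∀ i P, J i ≤ P.asIdeal → P ∈ t i := by
      intro i P hp
      rw [← (ht i).closure_eq, ← PrimeSpectrum.zeroLocus_vanishingIdeal_eq_closure]
      exact hp
    have hn : ¬ ((⨆ i, J i : Ideal C(X, ℝ)) : Set C(X, ℝ)) ⊆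
        ⋃ P ∈ 𝒜, (P.asIdeal : Set C(X, ℝ)) := by
      intro hs
      obtain ⟨P, hP, hle⟩ := H _ hs
      have : P ∈ 𝒜 ∩ ⋂ i, t i :=
        ⟨hP, Set.mem_iInter.2 fun i => hJ i P ((le_iSup J i).trans hle)⟩
      rw [he] at this
      exact this
    obtain ⟨f, hf, hfn⟩ := Set.not_subset.1 hn
    obtain ⟨u, hu⟩ := (Submodule.mem_iSup_iff_exists_finset).1 hf
    refine ⟨u, Set.eq_empty_iff_forall_notMem.2 ?_⟩
    rintro P ⟨hP, hPt⟩
    apply hfn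
    refine Set.mem_iUnion₂.2 ⟨P, hP, ?_⟩
    have hle : (⨆ i ∈ u, J i) ≤ P.asIdeal := iSup₂_le fun i hi g hg =>
      (PrimeSpectrum.mem_vanishingIdeal _ _).1 hg P (Set.mem_iInter₂.1 hPt i hi)
    exact hle hu
  · by_contra hcon
    push Not at hcon
    obtain ⟨u, hu⟩ := hc.elim_finite_subcover
      (fun f : I => (PrimeSpectrum.basicOpen (f : C(X, ℝ)) : Set (PrimeSpectrum C(X, ℝ))))
      (fun f => (PrimeSpectrum.basicOpen (f : C(X, ℝ))).isOpen) (by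
        intro P hP
        obtain ⟨f, hf, hfP⟩ := SetLike.not_le_iff_exists.1 (hcon P hP)
        exact Set.mem_iUnion.2 ⟨⟨f, hf⟩, hfP⟩)
    classical
    have hle : Ideal.span ((u.image Subtype.val : Finset C(X, ℝ)) : Set C(X, ℝ)) ≤ I := by
      rw [Ideal.span_le]
      intro f hf
      simp only [Finset.coe_image, Set.mem_image] at hf
      obtain ⟨g, _, rfl⟩ := hf
      exact g.2
    obtain ⟨P, hP, hPle⟩ := cX_fg 𝒜 _ ⟨u.image Subtype.val, rfl⟩ (Set.Subset.trans hle hI)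
    obtain ⟨f, hf, hfP⟩ := Set.mem_iUnion₂.1 (hu hP)
    exact hfP (hPle (Ideal.subset_span (Finset.mem_coe.2 (Finset.mem_image_of_mem _ hf))))
end

section
/- Let R be a commutative ring, X a topological space, and f : R → C(X) a ring homomorphism into the ring C(X) of continuous real-valued functions on X. If 𝒜 ⊆ Spec(C(X)) is compact in the Zariski topology, then the family 𝒜' = { f⁻¹(P) : P ∈ 𝒜 } of prime ideals of R has the prime avoidance property for R: if an ideal I of R satisfies I ⊆ ⋃_{P∈𝒜} f⁻¹(P), then I ⊆ f⁻¹(P) for some P ∈ 𝒜. -/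
theorem dvd_cube_aux {X : Type*} [TopologicalSpace X] (g h : C(X, ℝ))
    (H : ∀ x, g x ^ 2 ≤ h x) : h ∣ g ^ 3 := by
  have hz : ∀ x, h x = 0 → g x = 0 := fun x hx => by
    have := H x
    rw [hx] at this
    exact pow_eq_zero_iff (two_ne_zero) |>.1 (le_antisymm this (sq_nonneg _))
  have hb : ∀ x, |g x ^ 3 / h x| ≤ |g x| := fun x => by
    by_cases hx : h x = 0
    · simp [hx]
    · have hp : 0 < h x := lt_of_le_of_ne ((sq_nonneg _).trans (H x)) (Ne.symm hx)
      rw [abs_div, abs_of_pos hp, div_le_iff₀ hp, abs_pow, pow_succ, sq_abs, mul_comm]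
      exact mul_le_mul_of_nonneg_left (H x) (abs_nonneg _)
  have hc : Continuous fun x => g x ^ 3 / h x := by
    rw [continuous_iff_continuousAt]
    intro x
    by_cases hx : h x = 0
    · have hg := hz x hx
      have h1 : Filter.Tendsto (fun y => |g y|) (nhds x) (nhds 0) := by
        have := (g.continuous.abs).tendsto x
        simpa [hg] using this
      have h2 := squeeze_zero_norm (f := fun y => g y ^ 3 / h y) hb h1
      simpa [ContinuousAt, hx] using h2
    · exact ((g.continuous.pow 3).continuousAt).div h.continuous.continuousAt hx
  refine ⟨⟨_, hc⟩, ?_⟩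
  ext x
  by_cases hx : h x = 0
  · simp [hx, hz x hx]
  · simp only [ContinuousMap.pow_apply, ContinuousMap.mul_apply, ContinuousMap.coe_mk]
    field_simp

/-- for a ring homomorphism `f : R → C(X)` and a compact
`𝒜 ⊆ Spec C(X)`, the family `{f⁻¹(P) : P ∈ 𝒜}` has the prime avoidance property
for `R`. -/
theorem contraction_from_continuousMap_prime_avoidance
    {R : Type*} [CommRing R] {X : Type*} [TopologicalSpace X]
    (f : R →+* C(X, ℝ)) (𝒜 : Set (PrimeSpectrum C(X, ℝ))) (h𝒜 : IsCompact 𝒜) :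
    ∀ I : Ideal R,
      (I : Set R) ⊆ ⋃ P ∈ 𝒜, ((P.asIdeal.comap f : Ideal R) : Set R) →
      ∃ P ∈ 𝒜, I ≤ P.asIdeal.comap f := by
  intro I hI
  by_contra! hcon
  obtain ⟨t, ht⟩ := h𝒜.elim_finite_subcover
    (fun a : I => (PrimeSpectrum.basicOpen (f a) : Set (PrimeSpectrum C(X, ℝ))))
    (fun a => (PrimeSpectrum.basicOpen (f a)).isOpen) (by
      intro P hP
      obtain ⟨a, ha, haP⟩ := SetLike.not_le_iff_exists.1 (hcon P hP)
      exact Set.mem_iUnion.2 ⟨⟨a, ha⟩, haP⟩)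
  have hs : (∑ a ∈ t, (a : R) ^ 2) ∈ I :=
    I.sum_mem fun a _ => I.pow_mem_of_mem a.2 2 (by norm_num)
  obtain ⟨P, hP, hsP⟩ := Set.mem_iUnion₂.1 (hI hs)
  obtain ⟨a, hat, haP⟩ := Set.mem_iUnion₂.1 (ht hP)
  apply haP
  have hsP' : f (∑ a ∈ t, (a : R) ^ 2) ∈ P.asIdeal := hsP
  refine P.isPrime.mem_of_pow_mem 3 (P.asIdeal.mem_of_dvd (dvd_cube_aux _ _ ?_) hsP')
  intro x
  simp only [map_sum, map_pow, ContinuousMap.sum_apply, ContinuousMap.pow_apply]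
  exact Finset.single_le_sum (f := fun b : I => (f b x) ^ 2) (fun b _ => sq_nonneg _) hat
end

section
/- Let R be a commutative ring, X a topological space, and f : R → C(X) a ring homomorphism into the ring C(X) of continuous real-valued functions on X. For an ideal I of R, the extension I^e (the ideal of C(X) generated by f(I)) equals C(X) if and only if f(I) contains a unit of C(X). -/
theorem ext_aux
    {R : Type*} [CommRing R] {X : Type*} [TopologicalSpace X]
    (f : R →+* C(X, ℝ)) (I : Ideal R) (h : C(X, ℝ)) (hh : h ∈ I.map f) :
    ∃ a ∈ I, ∀ x, 0 ≤ f a x ∧ (f a x = 0 → h x = 0) := by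
  unfold Ideal.map at hh
  induction hh using Submodule.span_induction with
  | mem y hy =>
    obtain ⟨b, hb, rfl⟩ := hy
    refine ⟨b * b, I.mul_mem_left _ hb, fun x => ?_⟩
    simp [mul_self_nonneg]
  | zero => exact ⟨0, I.zero_mem, fun x => by simp⟩
  | add y z _ _ hy hz =>
    obtain ⟨a, ha, h1⟩ := hy
    obtain ⟨b, hb, h2⟩ := hz
    refine ⟨a + b, I.add_mem ha hb, fun x => ?_⟩
    obtain ⟨p, q⟩ := h1 x
    obtain ⟨r, s⟩ := h2 x
    simp only [map_add, ContinuousMap.add_apply]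
    refine ⟨by linarith, fun e => ?_⟩
    rw [q (by linarith), s (by linarith), add_zero]
  | smul c y _ hy =>
    obtain ⟨a, ha, h1⟩ := hy
    refine ⟨a, ha, fun x => ⟨(h1 x).1, fun e => ?_⟩⟩
    simp [(h1 x).2 e]

/-- for a ring homomorphism `f : R → C(X)` and an ideal `I` of `R`, the
extension `I^e = (f(I))C(X)` equals `C(X)` iff `f(I)` contains a unit of `C(X)`. -/
theorem extension_eq_top_iff_image_contains_unit
    {R : Type*} [CommRing R] {X : Type*} [TopologicalSpace X]
    (f : R →+* C(X, ℝ)) (I : Ideal R) :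
    I.map f = ⊤ ↔ ∃ g ∈ f '' (I : Set R), IsUnit g := by
  constructor
  · intro h
    obtain ⟨a, ha, h1⟩ := ext_aux f I 1 (h ▸ Submodule.mem_top)
    refine ⟨f a, ⟨a, ha, rfl⟩, ?_⟩
    rw [ContinuousMap.isUnit_iff_forall_ne_zero]
    intro x e
    exact one_ne_zero (α := ℝ) (by simpa using (h1 x).2 e)
  · rintro ⟨_, ⟨a, ha, rfl⟩, hu⟩
    exact Ideal.eq_top_of_isUnit_mem _ (Ideal.mem_map_of_mem f ha) hu
end

section
/- Let K be a formally real field (i.e., whenever a finite sum of squares a₁² + ⋯ + a_m² = 0 in K, then all a_i = 0), let n be a positive integer, and let X be a subset of the affine space K^n. For each point P ∈ K^n let M_P = { f ∈ K[x₁,…,x_n] : f(P) = 0 } be the maximal ideal of polynomials vanishing at P. Then the family ℳ_X = { M_P : P ∈ X } has the prime avoidance property for the polynomial ring K[x₁,…,x_n]: if an ideal I of K[x₁,…,x_n] satisfies I ⊆ ⋃_{P∈X} M_P, then I ⊆ M_P for some P ∈ X. -/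
/-- if `K` is a formally real field and `X ⊆ Kⁿ`, then the family of
maximal ideals `M_P = ker (eval at P)`, `P ∈ X`, of the polynomial ring
`K[x₁,…,xₙ]` has the prime avoidance property. -/
theorem formally_real_points_prime_avoidance
    {K : Type*} [Field K]
    (hFR : ∀ (m : ℕ) (a : Fin m → K), (∑ i, (a i) ^ 2) = 0 → ∀ i, a i = 0)
    (n : ℕ) (hn : 0 < n) (X : Set (Fin n → K)) :
    ∀ I : Ideal (MvPolynomial (Fin n) K),
      (I : Set (MvPolynomial (Fin n) K)) ⊆
          ⋃ P ∈ X, ((RingHom.ker (MvPolynomial.eval P) :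
              Ideal (MvPolynomial (Fin n) K)) : Set (MvPolynomial (Fin n) K)) →
      ∃ P ∈ X, I ≤ RingHom.ker (MvPolynomial.eval P) := by
  intro I hI
  obtain ⟨m, f, hf⟩ := Submodule.fg_iff_exists_fin_generating_family.mp
    (IsNoetherian.noetherian I)
  have hmem : ∀ i, f i ∈ I := fun i => by
    rw [← hf]
    exact Submodule.subset_span ⟨i, rfl⟩
  have hs : (∑ i, (f i) ^ 2) ∈ I :=
    Ideal.sum_mem _ fun i _ => Ideal.pow_mem_of_mem _ (hmem i) 2 (by norm_num)
  have h := hI hs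
  simp only [Set.mem_iUnion] at h
  obtain ⟨P, hP, h0⟩ := h
  refine ⟨P, hP, ?_⟩
  have h1 : MvPolynomial.eval P (∑ i, (f i) ^ 2) = 0 := h0
  rw [map_sum] at h1
  simp only [map_pow] at h1
  have h2 := hFR m (fun i => MvPolynomial.eval P (f i)) h1
  rw [← hf]
  refine Submodule.span_le.mpr ?_
  rintro _ ⟨i, rfl⟩
  exact h2 i
end

section
/- Let f : R → T be a homomorphism of commutative rings. (a) If 𝒜 ⊆ Spec(T) has the prime avoidance property for T, then 𝒜' = { f⁻¹(P) : P ∈ 𝒜 } ⊆ Spec(R) is compact in the Zariski topology on Spec(R). (b) If moreover T is integral over the image f(R), then ℳ = { f⁻¹(M) : M a maximal ideal of T } has the prime avoidance property for R. -/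
/-- for a ring homomorphism `f : R → T`:
(a) if `𝒜 ⊆ Spec T` has the prime avoidance property for `T`, then the set of
contractions `{f⁻¹(P) : P ∈ 𝒜}` is compact in the Zariski topology on `Spec R`;
(b) if `T` is integral over the image of `f`, then `{f⁻¹(M) : M maximal in T}` has
the prime avoidance property for `R`. -/
theorem contraction_compact_and_integral_prime_avoidance
    {R T : Type*} [CommRing R] [CommRing T] (f : R →+* T)
    (𝒜 : Set (PrimeSpectrum T)) :
    ((∀ I : Ideal T, (I : Set T) ⊆ ⋃ P ∈ 𝒜, (P.asIdeal : Set T) →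
        ∃ P ∈ 𝒜, I ≤ P.asIdeal) →
      IsCompact (PrimeSpectrum.comap f '' 𝒜)) ∧
    (f.IsIntegral →
      ∀ I : Ideal R,
        (I : Set R) ⊆
            ⋃ Q ∈ {Q : PrimeSpectrum R |
                ∃ M : Ideal T, M.IsMaximal ∧ Q.asIdeal = M.comap f},
              (Q.asIdeal : Set R) →
        ∃ Q ∈ {Q : PrimeSpectrum R |
            ∃ M : Ideal T, M.IsMaximal ∧ Q.asIdeal = M.comap f},
          I ≤ Q.asIdeal) := by
  refine ⟨fun h => ?_, fun hf I hI => ?_⟩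
  · refine IsCompact.image ?_ (PrimeSpectrum.continuous_comap f)
    refine isCompact_of_finite_subcover fun {ι} U hU hc => ?_
    have hJ : ∀ i, ∃ J : Ideal T, ∀ P : PrimeSpectrum T, P ∈ U i ↔ ¬ J ≤ P.asIdeal := by
      intro i
      obtain ⟨J, hJ⟩ := (PrimeSpectrum.isClosed_iff_zeroLocus_ideal _).1 (hU i).isClosed_compl
      refine ⟨J, fun P => ?_⟩
      rw [← not_iff_not, not_not, ← Set.mem_compl_iff, hJ, PrimeSpectrum.mem_zeroLocus]
      rfl
    choose J hJ using hJ
    have h1 : ¬ ((↑(⨆ i, J i) : Set T) ⊆ ⋃ P ∈ 𝒜, (P.asIdeal : Set T)) := by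
      intro hs
      obtain ⟨P, hP, hle⟩ := h _ hs
      obtain ⟨i, hi⟩ := Set.mem_iUnion.1 (hc hP)
      exact (hJ i P).1 hi ((le_iSup J i).trans hle)
    obtain ⟨x, hx, hx'⟩ := Set.not_subset.1 h1
    obtain ⟨s, hs⟩ := Submodule.mem_iSup_iff_exists_finset.1 hx
    refine ⟨s, fun P hP => ?_⟩
    by_contra hn
    apply hx'
    simp only [Set.mem_iUnion]
    refine ⟨P, hP, ?_⟩
    refine (iSup₂_le fun i hi => ?_ : (⨆ i ∈ s, J i) ≤ P.asIdeal) hs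
    by_contra hc'
    exact hn (Set.mem_iUnion₂.2 ⟨i, hi, (hJ i P).2 hc'⟩)
  · have hne : I.map f ≠ ⊤ := by
      intro ht
      have h2 : (I ⊔ RingHom.ker f).map f = ⊤ := by
        rw [Ideal.map_sup, ht, top_sup_eq]
      rw [Ideal.map_eq_top_iff_of_ker_le f le_sup_right hf] at h2
      obtain ⟨a, ha, b, hb, hab⟩ := Submodule.mem_sup.1 ((Ideal.eq_top_iff_one _).1 h2)
      have hfa : f a = 1 := by
        have := congrArg f hab
        rwa [map_add, (RingHom.mem_ker).1 hb, add_zero, map_one] at this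
      obtain ⟨Q, ⟨M, hM, hQ⟩, haQ⟩ := Set.mem_iUnion₂.1 (hI ha)
      have haM : a ∈ M.comap f := hQ ▸ haQ
      rw [Ideal.mem_comap, hfa] at haM
      exact hM.ne_top ((Ideal.eq_top_iff_one _).2 haM)
    obtain ⟨M, hM, hle⟩ := Ideal.exists_le_maximal _ hne
    have := hM.isPrime
    exact ⟨⟨M.comap f, inferInstance⟩, ⟨M, hM, rfl⟩, Ideal.map_le_iff_le_comap.1 hle⟩
end

section
/- Let K be a field, let V, V₁, …, V_n be valuation subrings of K, and let x ∈ K. If the subring V[x] of K generated by V and x is not contained in V₁ ∪ ⋯ ∪ V_n, then there exists v ∈ V such that v + x ∉ V₁ ∪ ⋯ ∪ V_n. -/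
open scoped Pointwise in
/-- valuation version of Davis' theorem. If `V, V₁, …, Vₙ` are valuation
subrings of a field `K`, `x ∈ K`, and the subring `V[x]` generated by `V` and `x` is
not contained in `V₁ ∪ ⋯ ∪ Vₙ`, then there is `v ∈ V` with `v + x ∉ V₁ ∪ ⋯ ∪ Vₙ`. -/
theorem valuation_davis_avoidance
    {K : Type*} [Field K] (V : ValuationSubring K) {n : ℕ}
    (W : Fin n → ValuationSubring K) (x : K)
    (h : ¬ ((Subring.closure (insert x (V : Set K)) : Set K) ⊆ ⋃ i, (W i : Set K))) :
    ∃ v ∈ V, v + x ∉ ⋃ i, (W i : Set K) := by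
  classical
  by_contra! hcon
  simp only [Set.mem_iUnion, SetLike.mem_coe] at hcon
  let H : Fin n → AddSubgroup V := fun i =>
    (W i).toSubring.toAddSubgroup.comap V.subtype.toAddMonoidHom
  have hH : ∀ i (a : V), a ∈ H i ↔ (a : K) ∈ W i := fun i a => Iff.rfl
  let s : Finset (Fin n) := Finset.univ.filter fun i => ∃ v : V, (v : K) + x ∈ W i
  let g : Fin n → V := fun i => if hi : ∃ v : V, (v : K) + x ∈ W i then hi.choose else 0
  have hg : ∀ i ∈ s, (g i : K) + x ∈ W i := by
    intro i hi
    have hi' : ∃ v : V, (v : K) + x ∈ W i := by simpa [s] using hi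
    simp only [g, dif_pos hi']
    exact hi'.choose_spec
  have hcov : ⋃ i ∈ s, (g i) +ᵥ (H i : Set V) = Set.univ := by
    refine Set.eq_univ_of_forall fun v => ?_
    obtain ⟨i, hi⟩ := hcon v v.2
    have his : i ∈ s := by simpa [s] using ⟨v, v.2, hi⟩
    refine Set.mem_iUnion₂.2 ⟨i, his, ?_⟩
    rw [Set.mem_vadd_set_iff_neg_vadd_mem]
    show (-g i + v : V) ∈ H i
    rw [hH]
    have := sub_mem hi (hg i his)
    convert this using 1
    push_cast
    ring
  obtain ⟨i, his, hfin⟩ := AddSubgroup.exists_finiteIndex_of_leftCoset_cover hcov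
  have hVW : ∀ a ∈ V, a ∈ W i := by
    intro a ha
    by_contra haW
    have : Finite (V ⧸ H i) := AddSubgroup.finite_quotient_of_finiteIndex
    obtain ⟨k, l, hkl, he⟩ := Finite.exists_ne_map_eq_of_infinite
      (fun k : ℕ => (QuotientAddGroup.mk ((⟨a, ha⟩ : V) ^ k) : V ⧸ H i))
    have key : ∀ k l : ℕ, k < l → a ^ k - a ^ l ∉ W i := by
      intro k l hkl hm
      rw [← ValuationSubring.valuation_le_one_iff, not_le] at haW
      rw [← ValuationSubring.valuation_le_one_iff,
        Valuation.map_sub_eq_of_lt_right, map_pow] at hm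
      · exact absurd hm (not_le.2 (one_lt_pow₀ haW (by omega)))
      · rw [map_pow, map_pow]
        exact pow_lt_pow_right₀ haW hkl
    have hm := (QuotientAddGroup.eq.1 he)
    rw [hH] at hm
    push_cast at hm
    rcases lt_or_gt_of_ne hkl with h1 | h1
    · apply key k l h1
      have := (W i).neg_mem _ hm
      convert this using 1
      ring
    · apply key l k h1
      convert hm using 1
      ring
  apply h
  refine fun y hy => Set.mem_iUnion.2 ⟨i, ?_⟩
  have hx : x ∈ W i := by
    have := sub_mem (hg i his) (hVW _ (g i).2)
    simpa using this
  have hle : Subring.closure (insert x (V : Set K)) ≤ (W i).toSubring := by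
    rw [Subring.closure_le]
    intro z hz
    rcases hz with rfl | hz
    · exact hx
    · exact hVW z hz
  exact hle hy
end
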